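/- arXiv:1801.08951 — 3 statements merged into one kernel-verified Lean document; each statement's English description precedes it below -/
import Mathlib

section
/- Let H be an m×n real matrix and let S be a set of row indices such that H^(−S) (H with the rows in S deleted) has nontrivial kernel, while for every k ∈ S the matrix H^(−(S∖{k})) (H^(−S) with row k added back) has trivial kernel. Then there exists c ∈ ℝⁿ such that the support of H·c is exactly S; i.e., every (algebraic) observability set is exactly the support of some stealthy data injection attack. (Forward direction of Theorem 4, single observability set) -/
/-- The submatrix of `H` obtained by deleting the rows indexed by `S`. -/
def delRows {m n : ℕ} (H : Matrix (Fin m) (Fin n) ℝ) (S : Set (Fin m)) :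
    Matrix {i : Fin m // i ∉ S} (Fin n) ℝ :=
  Matrix.of fun i j => H i.1 j

theorem delRows_mulVec_eq_zero_iff {m n : ℕ} (H : Matrix (Fin m) (Fin n) ℝ) (S : Set (Fin m))
    (c : Fin n → ℝ) : (delRows H S).mulVec c = 0 ↔ ∀ i ∉ S, H.mulVec c i = 0 :=
  ⟨fun h i hi => congrFun h ⟨i, hi⟩, fun h => funext fun i => h i.1 i.2⟩

/-- Forward direction of Theorem 4 (single observability set): if `H^(−S)` has nontrivial
kernel while adding back any single row `k ∈ S` makes the kernel trivial, then there is a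
stealthy data injection attack `H·c` whose support is exactly `S`. -/
theorem observability_set_is_support_of_stealthy_attack
    {m n : ℕ} (H : Matrix (Fin m) (Fin n) ℝ) (S : Set (Fin m))
    (hker : ∃ c : Fin n → ℝ, c ≠ 0 ∧ (delRows H S).mulVec c = 0)
    (hmin : ∀ k ∈ S, ∀ c : Fin n → ℝ, (delRows H (S \ {k})).mulVec c = 0 → c = 0) :
    ∃ c : Fin n → ℝ, Function.support (H.mulVec c) = S := by
  obtain ⟨c, hc, h⟩ := hker
  rw [delRows_mulVec_eq_zero_iff] at h
  refine ⟨c, Set.Subset.antisymm (fun i hi => by_contra fun hiS => hi (h i hiS)) ?_⟩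
  intro k hk hk0
  refine hc (hmin k hk c ((delRows_mulVec_eq_zero_iff H _ c).2 fun i hi => ?_))
  by_cases hik : i = k
  · exact hik ▸ hk0
  · exact h i fun hiS => hi ⟨hiS, hik⟩
end

section
/- Let H be an m×n real matrix with full column rank and let c ∈ ℝⁿ be nonzero. Then for every index i in the support of H·c there exists a nonzero c' ∈ ℝⁿ such that i ∈ support(H·c'), support(H·c') ⊆ support(H·c), and support(H·c') is minimal among the supports of nonzero stealthy attacks (i.e., it is an observability set). Hence the support of every stealthy data injection attack is a union of observability sets. (Converse direction of Theorem 4, algebraic form) -/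
/-- In a subspace `V` of `ι → K` with `ι` finite, every coordinate in the support of a vector of `V`
lies in the support of a vector of `V` whose support is contained in the given one and minimal
among the supports of nonzero vectors of `V`. -/
theorem Submodule.exists_minimal_support_of_mem_support {K ι : Type*} [Field K] [Finite ι]
    (V : Submodule K (ι → K)) {a : ι → K} (ha : a ∈ V) {i : ι} (hi : i ∈ Function.support a) :
    ∃ v ∈ V, i ∈ Function.support v ∧ Function.support v ⊆ Function.support a ∧
      ∀ w ∈ V, w ≠ 0 → ¬ Function.support w ⊂ Function.support v := by
  obtain ⟨S, hSa, ⟨v, hv, hiv, rfl⟩, hmin⟩ :=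
    (Set.toFinite {S : Set ι | ∃ v ∈ V, i ∈ Function.support v ∧ Function.support v = S}
      ).exists_le_minimal ⟨a, ha, hi, rfl⟩
  refine ⟨v, hv, hiv, hSa, fun w hw hw0 hwv => ?_⟩
  by_cases hiw : i ∈ Function.support w
  · exact hwv.2 (hmin ⟨w, hw, hiw, rfl⟩ hwv.1)
  · obtain ⟨j, hj⟩ := Function.ne_iff.mp hw0
    have hj' : w j ≠ 0 := hj
    have hwi : w i = 0 := Function.notMem_support.mp hiw
    -- Cancelling the coordinate `j` against `w` keeps `i` but strictly shrinks the support.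
    let u : ι → K := v - (v j / w j) • w
    have huv : Function.support u ⊆ Function.support v := fun k hk hvk => by
      have hwk : w k = 0 := by
        by_contra h
        exact hwv.1 h hvk
      exact hk (by simp [u, hvk, hwk])
    have hiu : i ∈ Function.support u := by simpa [u, hwi] using hiv
    have hju : u j = 0 := by simp [u, hj']
    exact hmin ⟨u, V.sub_mem hv (V.smul_mem _ hw), hiu, rfl⟩ huv (hwv.1 hj') hju

theorem Matrix.mulVec_injective_of_rank_eq_card {K m n : Type*} [Field K] [Fintype m] [Fintype n]
    (A : Matrix m n K) (hA : A.rank = Fintype.card n) : Function.Injective A.mulVec := by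
  rw [Matrix.mulVec_injective_iff, linearIndependent_iff_card_eq_finrank_span, ← hA,
    Matrix.rank_eq_finrank_span_cols]
  rfl


/-- Converse direction of Theorem 4 (algebraic form): for `H` of full column rank and a
nonzero `c`, every index `i` in the support of the stealthy attack `H·c` lies in the
support of some nonzero stealthy attack `H·c'` contained in `support (H·c)` and minimal
among supports of nonzero stealthy attacks (i.e., an observability set). Hence the support
of every stealthy data injection attack is a union of observability sets. -/
theorem stealthy_attack_support_is_union_of_minimal_supports
    {m n : ℕ} (H : Matrix (Fin m) (Fin n) ℝ) (hH : H.rank = n)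
    (c : Fin n → ℝ) (hc : c ≠ 0) :
    ∀ i ∈ Function.support (H.mulVec c),
      ∃ c' : Fin n → ℝ, c' ≠ 0 ∧ i ∈ Function.support (H.mulVec c') ∧
        Function.support (H.mulVec c') ⊆ Function.support (H.mulVec c) ∧
        ∀ c'' : Fin n → ℝ, c'' ≠ 0 →
          ¬ Function.support (H.mulVec c'') ⊂ Function.support (H.mulVec c') := by
  intro i hi
  have hinj := H.mulVec_injective_of_rank_eq_card (by simpa using hH)
  obtain ⟨_, ⟨c', rfl⟩, hi', hsub, hmin⟩ :=
    H.mulVecLin.range.exists_minimal_support_of_mem_support ⟨c, rfl⟩ hi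
  refine ⟨c', ?_, hi', hsub, fun c'' hc'' => hmin _ ⟨c'', rfl⟩ ?_⟩
  · rintro rfl
    simp at hi'
  · exact fun h => hc'' (hinj (h.trans H.mulVec_zero.symm))
end

section
/- Let H be an m×n real matrix with full column rank, let τ be a natural number, and let D be a set of row indices that intersects every (algebraic) observability set of H of cardinality strictly less than τ. Then for every c ∈ ℝⁿ with H·c ≠ 0 and |support(H·c)| < τ, we have support(H·c) ∩ D ≠ ∅; i.e., protecting the measurements in D forces any stealthy attack avoiding the protected measurements to manipulate at least τ measurements. (Algebraic form of Proposition 2 / Problem 4) -/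
/-- `S` is an (algebraic) observability set: `H^(−S)` has nontrivial kernel, while adding
back any single row `k ∈ S` yields a matrix with trivial kernel. -/
def IsObsSet {m n : ℕ} (H : Matrix (Fin m) (Fin n) ℝ) (S : Set (Fin m)) : Prop :=
  (∃ c : Fin n → ℝ, c ≠ 0 ∧ (delRows H S).mulVec c = 0) ∧
  (∀ k ∈ S, ∀ c : Fin n → ℝ, (delRows H (S \ {k})).mulVec c = 0 → c = 0)

/-- Deleting the support of `H c` leaves a matrix that annihilates `c`. -/
theorem delRows_support_mulVec {m n : ℕ} (H : Matrix (Fin m) (Fin n) ℝ) (c : Fin n → ℝ) :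
    (delRows H (Function.support (H.mulVec c))).mulVec c = 0 := by
  funext i
  exact Function.notMem_support.mp i.2

/-- A set of rows whose deletion produces a nontrivial kernel contains an observability set. -/
theorem exists_isObsSet_subset {m n : ℕ} (H : Matrix (Fin m) (Fin n) ℝ) {T : Set (Fin m)}
    (hT : ∃ c : Fin n → ℝ, c ≠ 0 ∧ (delRows H T).mulVec c = 0) :
    ∃ S ⊆ T, IsObsSet H S := by
  obtain ⟨S, hST, hS⟩ := exists_minimal_le_of_wellFoundedLT
    (fun S : Set (Fin m) => ∃ c : Fin n → ℝ, c ≠ 0 ∧ (delRows H S).mulVec c = 0) T hT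
  refine ⟨S, hST, hS.prop, fun k hk c hc => ?_⟩
  by_contra hc0
  exact (hS.le_of_le ⟨c, hc0, hc⟩ Set.sdiff_subset hk).2 rfl

/-- Algebraic form of Proposition 2 / Problem 4: if `H` has full column rank and `D` is a
set of measurements intersecting every observability set of cardinality `< τ`, then every
nonzero stealthy attack with support of cardinality `< τ` touches `D`: protecting `D`
forces any stealthy attack avoiding the protected measurements to manipulate at least `τ`
measurements. -/
theorem protecting_hitting_set_forces_large_attacks
    {m n : ℕ} (H : Matrix (Fin m) (Fin n) ℝ) (hH : H.rank = n) (τ : ℕ)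
    (D : Set (Fin m))
    (hD : ∀ S : Set (Fin m), IsObsSet H S → S.ncard < τ → (S ∩ D).Nonempty) :
    ∀ c : Fin n → ℝ, H.mulVec c ≠ 0 → (Function.support (H.mulVec c)).ncard < τ →
      (Function.support (H.mulVec c) ∩ D).Nonempty := by
  intro c hc hcard
  have hc0 : c ≠ 0 := by
    rintro rfl
    exact hc H.mulVec_zero
  obtain ⟨S, hS, hobs⟩ := exists_isObsSet_subset H ⟨c, hc0, delRows_support_mulVec H c⟩
  have hSτ : S.ncard < τ := (Set.ncard_le_ncard hS (Set.toFinite _)).trans_lt hcard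
  exact (hD S hobs hSτ).mono (Set.inter_subset_inter_left D hS)
end
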